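/- arXiv:2108.09095 — 2 statements merged into one kernel-verified Lean document; each statement's English description precedes it below -/
import Mathlib

section
/- Let α ≥ 0 be a real number and let β ≥ 1 and n be integers with 2β + 2 ≤ n < ((2α+3)β + α + 2)/(α+1). Then ρ_α(K_β ∨ K̄_{n−β}) < 2(α+1)β. -/
open scoped Classical

/-- The adjacency matrix of a graph, over ℝ. -/
noncomputable def adjMat {V : Type*} [Fintype V] (G : SimpleGraph V) : Matrix V V ℝ :=
  fun i j => if G.Adj i j then 1 else 0

/-- The diagonal matrix of vertex degrees, over ℝ. -/
noncomputable def degMat {V : Type*} [Fintype V] (G : SimpleGraph V) : Matrix V V ℝ :=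
  fun i j => if i = j then ((G.neighborSet i).ncard : ℝ) else 0

/-- The largest (real) eigenvalue of a matrix. -/
noncomputable def specRad {V : Type*} [Fintype V] (M : Matrix V V ℝ) : ℝ :=
  sSup {t : ℝ | ∃ v : V → ℝ, v ≠ 0 ∧ M.mulVec v = t • v}

/-- The α-spectral radius: the largest eigenvalue of A_α(G) = α·D(G) + A(G). -/
noncomputable def alphaRadius {V : Type*} [Fintype V] (α : ℝ) (G : SimpleGraph V) : ℝ :=
  specRad (α • degMat G + adjMat G)

/-- The matching number of a graph. -/
noncomputable def matchingNumber {V : Type*} [Fintype V] (G : SimpleGraph V) : ℕ :=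
  sSup {m : ℕ | ∃ M : G.Subgraph, M.IsMatching ∧ M.edgeSet.ncard = m}

/-- The join of two graphs. -/
def graphJoin {A B : Type*} (G : SimpleGraph A) (H : SimpleGraph B) : SimpleGraph (A ⊕ B) :=
  SimpleGraph.fromRel (fun x y => match x, y with
    | Sum.inl a, Sum.inl b => G.Adj a b
    | Sum.inr a, Sum.inr b => H.Adj a b
    | _, _ => True)

/-- The disjoint union of two graphs. -/
def graphSum {A B : Type*} (G : SimpleGraph A) (H : SimpleGraph B) : SimpleGraph (A ⊕ B) :=
  SimpleGraph.fromRel (fun x y => match x, y with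
    | Sum.inl a, Sum.inl b => G.Adj a b
    | Sum.inr a, Sum.inr b => H.Adj a b
    | _, _ => False)

/-- The number of odd components of G − S. -/
noncomputable def oddComponentsOutside {V : Type*} [Fintype V] (G : SimpleGraph V) (S : Set V) : ℕ :=
  Set.ncard {c : (G.induce Sᶜ).ConnectedComponent | Odd c.supp.ncard}

/-- The disjoint union of cliques K_{f 0} ∪ ⋯ ∪ K_{f (q-1)}. -/
def cliquesUnion (q : ℕ) (f : Fin q → ℕ) : SimpleGraph (Σ i : Fin q, Fin (f i)) :=
  SimpleGraph.fromRel (fun x y => x.1 = y.1)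

/-- Collatz–Wielandt bound: a nonnegative matrix with a positive vector `w` such that
`M w ≤ c w` has no real eigenvalue above `c`. -/
theorem specRad_le_of_mulVec_le {V : Type*} [Fintype V] (M : Matrix V V ℝ) (w : V → ℝ) (c : ℝ)
    (hM : ∀ i j, 0 ≤ M i j) (hw : ∀ i, 0 < w i) (hc : 0 ≤ c)
    (h : ∀ i, M.mulVec w i ≤ c * w i) : specRad M ≤ c := by
  refine Real.sSup_le ?_ hc
  rintro t ⟨v, hv, hvt⟩
  obtain ⟨k, hk⟩ := Function.ne_iff.mp hv
  obtain ⟨i, -, hi⟩ := Finset.exists_max_image Finset.univ (fun i => |v i| / w i) ⟨k, by simp⟩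
  set m := |v i| / w i with hm
  have hle (j : V) : |v j| ≤ m * w j := (div_le_iff₀ (hw j)).mp (hi j (by simp))
  have hmpos : 0 < m := lt_of_lt_of_le (div_pos (abs_pos.mpr hk) (hw k)) (hi k (by simp))
  have hvi : |v i| = m * w i := by rw [hm, div_mul_cancel₀ _ (hw i).ne']
  have hrow : t * v i = ∑ j, M i j * v j := by
    simpa [Matrix.mulVec, dotProduct] using (congrFun hvt i).symm
  have key : t * |v i| ≤ c * |v i| := calc
    t * |v i| ≤ |t| * |v i| := by gcongr; exact le_abs_self t
    _ = |∑ j, M i j * v j| := by rw [← abs_mul, hrow]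
    _ ≤ ∑ j, |M i j * v j| := Finset.abs_sum_le_sum_abs _ _
    _ ≤ ∑ j, m * (M i j * w j) := by
      refine Finset.sum_le_sum fun j _ => ?_
      rw [abs_mul, abs_of_nonneg (hM i j)]
      nlinarith [mul_le_mul_of_nonneg_left (hle j) (hM i j)]
    _ = m * M.mulVec w i := by rw [← Finset.mul_sum]; rfl
    _ ≤ m * (c * w i) := by gcongr; exact h i
    _ = c * |v i| := by rw [hvi]; ring
  exact le_of_mul_le_mul_right key (hvi ▸ mul_pos hmpos (hw i))

theorem ncard_neighborSet_eq_sum {V : Type*} [Fintype V] (G : SimpleGraph V) (i : V) :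
    ((G.neighborSet i).ncard : ℝ) = ∑ j, if G.Adj i j then 1 else 0 := by
  rw [Set.ncard_eq_toFinset_card', Finset.sum_boole]
  congr 2
  ext j
  simp

/-- The rows of `A_α` act by `α d(i) w(i) + ∑_{j ∼ i} w(j)`. -/
theorem alphaMatrix_mulVec {V : Type*} [Fintype V] (α : ℝ) (G : SimpleGraph V) (w : V → ℝ)
    (i : V) : (α • degMat G + adjMat G).mulVec w i =
      α * (∑ j, if G.Adj i j then 1 else 0) * w i + ∑ j, if G.Adj i j then w j else 0 := by
  rw [← ncard_neighborSet_eq_sum]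
  simp [Matrix.mulVec, dotProduct, degMat, adjMat, add_mul, Finset.sum_add_distrib]

theorem alphaMatrix_nonneg {V : Type*} [Fintype V] {α : ℝ} (hα : 0 ≤ α) (G : SimpleGraph V)
    (i j : V) : 0 ≤ (α • degMat G + adjMat G) i j := by
  simp only [Matrix.add_apply, Matrix.smul_apply, smul_eq_mul, degMat, adjMat]
  positivity

section Join

variable {p q : ℕ}

theorem graphJoin_top_bot_adj_inl_inl (a b : Fin p) :
    (graphJoin (⊤ : SimpleGraph (Fin p)) (⊥ : SimpleGraph (Fin q))).Adj (.inl a) (.inl b) ↔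
      a ≠ b := by
  simp [graphJoin, eq_comm]

theorem graphJoin_top_bot_adj_inl_inr (a : Fin p) (b : Fin q) :
    (graphJoin (⊤ : SimpleGraph (Fin p)) (⊥ : SimpleGraph (Fin q))).Adj (.inl a) (.inr b) := by
  simp [graphJoin]

theorem graphJoin_top_bot_adj_inr_inl (a : Fin q) (b : Fin p) :
    (graphJoin (⊤ : SimpleGraph (Fin p)) (⊥ : SimpleGraph (Fin q))).Adj (.inr a) (.inl b) := by
  simp [graphJoin]

theorem graphJoin_top_bot_not_adj_inr_inr (a b : Fin q) :
    ¬ (graphJoin (⊤ : SimpleGraph (Fin p)) (⊥ : SimpleGraph (Fin q))).Adj (.inr a) (.inr b) := by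
  simp [graphJoin]

theorem sum_ite_ne_const (a : Fin p) (x : ℝ) :
    (∑ b, if a ≠ b then x else 0) = (p - 1) * x := by
  have (b : Fin p) : (if a ≠ b then x else 0) = x - if a = b then x else 0 := by
    split_ifs <;> simp_all
  simp [this, sub_mul]

theorem alphaRadius_graphJoin_top_bot_le {α x c : ℝ} (hα : 0 ≤ α) (hx : 0 < x) (hc : 0 ≤ c)
    (htop : α * (p - 1 + q) * x + ((p - 1) * x + q) ≤ c * x) (hbot : α * p + p * x ≤ c) :
    alphaRadius α (graphJoin (⊤ : SimpleGraph (Fin p)) (⊥ : SimpleGraph (Fin q))) ≤ c := by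
  refine specRad_le_of_mulVec_le _ (Sum.elim (fun _ => x) fun _ => 1) c
    (alphaMatrix_nonneg hα _) (by rintro (_ | _) <;> simp [hx]) hc ?_
  rintro (a | a)
  · rw [alphaMatrix_mulVec]
    simp only [Fintype.sum_sum_type, graphJoin_top_bot_adj_inl_inl, graphJoin_top_bot_adj_inl_inr,
      Sum.elim_inl, Sum.elim_inr, sum_ite_ne_const]
    simpa using htop
  · rw [alphaMatrix_mulVec]
    simp only [Fintype.sum_sum_type, graphJoin_top_bot_adj_inr_inl,
      graphJoin_top_bot_not_adj_inr_inr, Sum.elim_inl, Sum.elim_inr]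
    simpa using hbot

end Join

theorem stmt17 (α : ℝ) (hα : 0 ≤ α) (n β : ℕ) (hβ : 1 ≤ β) (h1 : 2 * β + 2 ≤ n)
    (h2 : (n : ℝ) < ((2 * α + 3) * β + α + 2) / (α + 1)) :
    alphaRadius α (graphJoin (⊤ : SimpleGraph (Fin β)) (⊥ : SimpleGraph (Fin (n - β)))) <
      2 * (α + 1) * β := by
  have hq : ((n - β : ℕ) : ℝ) = n - β := Nat.cast_sub (by omega)
  have hb : (1 : ℝ) ≤ β := by exact_mod_cast hβ
  have hn : 2 * (β : ℝ) + 2 ≤ n := by exact_mod_cast h1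
  rw [lt_div_iff₀ (by positivity)] at h2
  set r : ℝ := 2 * (α + 1) * β - α * (n - 1) - (β - 1) with hr
  have hgap : (n : ℝ) - β < (α + 2) * r := by
    nlinarith [mul_lt_mul_of_pos_right h2 (by positivity : (0 : ℝ) < α + 1)]
  have hrpos : 0 < r := pos_of_mul_pos_right (by linarith : 0 < (α + 2) * r) (by positivity)
  obtain ⟨x, hx1, hx2⟩ := exists_between ((div_lt_iff₀ hrpos).mpr hgap)
  have hx : 0 < x := lt_trans (div_pos (by linarith) hrpos) hx1
  rw [div_lt_iff₀ hrpos] at hx1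
  have hbot : α * β + β * x < 2 * (α + 1) * β := by nlinarith
  have htop : (α * (n - 1) * x + ((β - 1) * x + (n - β))) / x < 2 * (α + 1) * β := by
    rw [div_lt_iff₀ hx]
    nlinarith
  refine lt_of_le_of_lt (alphaRadius_graphJoin_top_bot_le hα hx
    (le_max_of_le_right (by positivity)) ?_ (le_max_right _ _)) (max_lt htop hbot)
  rw [hq]
  refine le_trans (le_of_eq ?_) (mul_le_mul_of_nonneg_right (le_max_left _ _) hx.le)
  rw [div_mul_cancel₀ _ hx.ne']
  ring
end

section
/- Let α ≥ 0 be a real number and let β ≥ 1 and n be integers with n > ((2α+3)β + α + 2)/(α+1). Then ρ_α(K_β ∨ K̄_{n−β}) > 2(α+1)β. -/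
open scoped Classical

theorem degMat_mulVec {V : Type*} [Fintype V] (G : SimpleGraph V) (v : V → ℝ) (i : V) :
    (degMat G).mulVec v i = ((G.neighborSet i).ncard : ℝ) * v i := by
  simp [Matrix.mulVec, dotProduct, degMat]

theorem bddAbove_eigenvalues {V : Type*} [Fintype V] (M : Matrix V V ℝ) :
    BddAbove {t : ℝ | ∃ v : V → ℝ, v ≠ 0 ∧ M.mulVec v = t • v} := by
  refine ((Module.End.finite_hasEigenvalue (Matrix.toLin' M)).subset ?_).bddAbove
  rintro t ⟨v, hv, h⟩
  exact Module.End.hasEigenvalue_of_hasEigenvector (x := v)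
    ⟨Module.End.mem_eigenspace_iff.2 (by simpa using h), hv⟩

theorem le_specRad {V : Type*} [Fintype V] {M : Matrix V V ℝ} {t : ℝ} {v : V → ℝ} (hv : v ≠ 0)
    (h : M.mulVec v = t • v) : t ≤ specRad M :=
  le_csSup (bddAbove_eigenvalues M) ⟨v, hv, h⟩

theorem ncard_neighborSet_graphJoin_inl (b m : ℕ) (i : Fin b) :
    ((graphJoin (⊤ : SimpleGraph (Fin b)) (⊥ : SimpleGraph (Fin m))).neighborSet
      (Sum.inl i)).ncard = b + m - 1 := by
  have h : (graphJoin (⊤ : SimpleGraph (Fin b)) (⊥ : SimpleGraph (Fin m))).neighborSet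
      (Sum.inl i) = {Sum.inl i}ᶜ := by
    ext (j | j) <;> simp [graphJoin, eq_comm]
  rw [h, Set.ncard_compl, Set.ncard_singleton]
  simp

theorem ncard_neighborSet_graphJoin_inr (b m : ℕ) (i : Fin m) :
    ((graphJoin (⊤ : SimpleGraph (Fin b)) (⊥ : SimpleGraph (Fin m))).neighborSet
      (Sum.inr i)).ncard = b := by
  have h : (graphJoin (⊤ : SimpleGraph (Fin b)) (⊥ : SimpleGraph (Fin m))).neighborSet
      (Sum.inr i) = Set.range Sum.inl := by
    ext (j | j) <;> simp [graphJoin]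
  rw [h, ← Set.image_univ, Set.ncard_image_of_injective _ Sum.inl_injective]
  simp

theorem adjMat_graphJoin_mulVec_inl (b m : ℕ) (x y : ℝ) (i : Fin b) :
    (adjMat (graphJoin (⊤ : SimpleGraph (Fin b)) (⊥ : SimpleGraph (Fin m)))).mulVec
      (Sum.elim (fun _ => x) (fun _ => y)) (Sum.inl i) = ((b : ℝ) - 1) * x + m * y := by
  have h (j : Fin b) : (if i = j then (0 : ℝ) else x) = x - if i = j then x else 0 := by
    split_ifs <;> simp
  simp [Matrix.mulVec, dotProduct, adjMat, graphJoin, Fintype.sum_sum_type, eq_comm, h, sub_mul]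

theorem adjMat_graphJoin_mulVec_inr (b m : ℕ) (x y : ℝ) (i : Fin m) :
    (adjMat (graphJoin (⊤ : SimpleGraph (Fin b)) (⊥ : SimpleGraph (Fin m)))).mulVec
      (Sum.elim (fun _ => x) (fun _ => y)) (Sum.inr i) = b * x := by
  simp [Matrix.mulVec, dotProduct, adjMat, graphJoin, Fintype.sum_sum_type]

/-- A point where `(X - a) (X - b) < c` lies strictly below the larger solution of
`(X - a) (X - b) = c`. -/
theorem exists_gt_root_of_mul_lt {a b c s : ℝ} (hc : 0 ≤ c) (hs : (s - a) * (s - b) < c) :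
    ∃ t, s < t ∧ (t - a) * (t - b) = c := by
  have hd : 0 ≤ (a - b) ^ 2 + 4 * c := by positivity
  have hr := Real.sq_sqrt hd
  have hr0 := Real.sqrt_nonneg ((a - b) ^ 2 + 4 * c)
  set r := √((a - b) ^ 2 + 4 * c)
  refine ⟨(a + b + r) / 2, ?_, by nlinarith⟩
  by_contra! h
  have h' : (a + b - r) / 2 ≤ s := by linarith
  nlinarith [mul_nonneg (sub_nonneg.2 h) (sub_nonneg.2 h')]

theorem stmt18 (α : ℝ) (hα : 0 ≤ α) (n β : ℕ) (hβ : 1 ≤ β)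
    (h2 : (n : ℝ) > ((2 * α + 3) * β + α + 2) / (α + 1)) :
    alphaRadius α (graphJoin (⊤ : SimpleGraph (Fin β)) (⊥ : SimpleGraph (Fin (n - β)))) >
      2 * (α + 1) * β := by
  have hα1 : 0 < α + 1 := by linarith
  have hβ1 : (1 : ℝ) ≤ β := by exact_mod_cast hβ
  rw [gt_iff_lt, div_lt_iff₀ hα1] at h2
  have hβn : β ≤ n := by
    have : (β : ℝ) < n := by
      by_contra! h
      nlinarith [mul_le_mul_of_nonneg_right h hα1.le, mul_nonneg hα (zero_le_one.trans hβ1)]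
    exact_mod_cast this.le
  obtain ⟨m, rfl⟩ := Nat.exists_eq_add_of_le hβn
  rw [Nat.add_sub_cancel_left]
  push_cast at h2
  obtain ⟨t, ht, hroot⟩ := exists_gt_root_of_mul_lt (a := α * (β + m - 1) + β - 1) (b := α * β)
    (c := m * β) (s := 2 * (α + 1) * β) (by positivity) (by
      have h := mul_lt_mul_of_pos_right h2 (mul_pos hα1 (zero_lt_one.trans_le hβ1))
      nlinarith)
  refine ht.trans_le (le_specRad (v := Sum.elim (fun _ => t - α * β) (fun _ => (β : ℝ))) ?_ ?_)
  · intro h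
    have := congrFun h (Sum.inl ⟨0, hβ⟩)
    simp only [Sum.elim_inl, Pi.zero_apply] at this
    nlinarith
  · ext (i | i)
    · rw [Matrix.add_mulVec, Matrix.smul_mulVec, Pi.add_apply, Pi.smul_apply, degMat_mulVec,
        ncard_neighborSet_graphJoin_inl, adjMat_graphJoin_mulVec_inl, Nat.cast_sub (by omega)]
      simp only [Sum.elim_inl, Pi.smul_apply, smul_eq_mul]
      push_cast
      linear_combination -hroot
    · rw [Matrix.add_mulVec, Matrix.smul_mulVec, Pi.add_apply, Pi.smul_apply, degMat_mulVec,
        ncard_neighborSet_graphJoin_inr, adjMat_graphJoin_mulVec_inr]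
      simp only [Sum.elim_inr, Pi.smul_apply, smul_eq_mul]
      ring
end
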